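/- Let G be a minimally imperfect graph with a skew partition A, B, C, D. Then no clique of G of cardinality ω(G) is contained in A ∪ B. -/

import Mathlib

open SimpleGraph

/-- A graph is perfect if, in every induced subgraph, the clique number equals
the chromatic number. -/
def IsPerfect {V : Type*} (G : SimpleGraph V) : Prop :=
  ∀ S : Set V, ((G.induce S).cliqueNum : ℕ∞) = (G.induce S).chromaticNumber

/-- A graph is minimally imperfect if it is not perfect but every proper induced
subgraph of it is perfect. -/
def MinimallyImperfect {V : Type*} (G : SimpleGraph V) : Prop :=
  ¬ IsPerfect G ∧ ∀ S : Set V, S ≠ Set.univ → IsPerfect (G.induce S)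

/-- `A, B, C, D` form a skew partition of `G`: all four sets are nonempty, they
partition the vertex set, every vertex of `A` is adjacent to every vertex of `B`,
and there are no edges between `C` and `D`. -/
def IsSkewPartition {V : Type*} (G : SimpleGraph V) (A B C D : Set V) : Prop :=
  A.Nonempty ∧ B.Nonempty ∧ C.Nonempty ∧ D.Nonempty ∧
  A ∪ B ∪ C ∪ D = Set.univ ∧
  Disjoint A B ∧ Disjoint A C ∧ Disjoint A D ∧
  Disjoint B C ∧ Disjoint B D ∧ Disjoint C D ∧
  (∀ a ∈ A, ∀ b ∈ B, G.Adj a b) ∧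
  (∀ c ∈ C, ∀ d ∈ D, ¬ G.Adj c d)

/-- A graph has a skew partition if its vertex set admits one. -/
def HasSkewPartition {V : Type*} (G : SimpleGraph V) : Prop :=
  ∃ A B C D : Set V, IsSkewPartition G A B C D

theorem IsPerfect.colorable_cliqueNum {V : Type*} [Finite V] {G : SimpleGraph V}
    (h : IsPerfect G) : G.Colorable G.cliqueNum := by
  have huniv : (G.induce Set.univ).Colorable (G.induce Set.univ).cliqueNum :=
    chromaticNumber_le_iff_colorable.1 (h Set.univ).ge
  exact (huniv.mono (cliqueNum_induce_le Set.univ)).of_hom (induceUnivIso G).symm.toHom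

theorem cliqueNum_le_cliqueNum_induce_univ {V : Type*} [Finite V] (G : SimpleGraph V) :
    G.cliqueNum ≤ (G.induce Set.univ).cliqueNum := by
  obtain ⟨s, hs⟩ := G.exists_isNClique_cliqueNum
  let t : Finset (Set.univ : Set V) := s.map (Equiv.Set.univ V).symm.toEmbedding
  have ht : (G.induce Set.univ).IsClique t := by
    intro x hx y hy hxy
    simp only [t, Finset.coe_map, Set.mem_image] at hx hy
    obtain ⟨a, ha, rfl⟩ := hx
    obtain ⟨b, hb, rfl⟩ := hy
    exact hs.isClique ha hb fun hab => hxy (congrArg _ hab)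
  have := IsClique.card_le_cliqueNum (tc := ht)
  rwa [Finset.card_map, hs.card_eq] at this

theorem MinimallyImperfect.not_colorable_cliqueNum {V : Type*} [Finite V]
    {G : SimpleGraph V} (h : MinimallyImperfect G) : ¬ G.Colorable G.cliqueNum := by
  intro hc
  refine h.1 fun S => le_antisymm cliqueNum_le_chromaticNumber ?_
  rw [chromaticNumber_le_iff_colorable]
  by_cases hS : S = Set.univ
  · subst hS
    exact (hc.mono (cliqueNum_le_cliqueNum_induce_univ G)).of_hom (induceUnivIso G).toHom
  · exact (h.2 S hS).colorable_cliqueNum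

theorem MinimallyImperfect.colorable_induce {V : Type*} [Finite V] {G : SimpleGraph V}
    (h : MinimallyImperfect G) {S : Set V} (hS : S ≠ Set.univ) {n : ℕ}
    (hn : ∀ s : Finset V, G.IsClique s → ↑s ⊆ S → s.card ≤ n) :
    (G.induce S).Colorable n := by
  refine (h.2 S hS).colorable_cliqueNum.mono ?_
  obtain ⟨t, ht⟩ := (G.induce S).exists_isNClique_cliqueNum
  rw [isNClique_induce_iff] at ht
  rw [← ht.card_eq]
  refine hn _ ht.isClique fun v hv => ?_
  simp only [Finset.coe_map, Set.mem_image] at hv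
  obtain ⟨x, -, rfl⟩ := hv
  exact x.2

theorem colorable_add_of_induce_compl {V : Type*} {G : SimpleGraph V} {S : Set V} {m n : ℕ}
    (hm : (G.induce S).Colorable m) (hn : (G.induce Sᶜ).Colorable n) :
    G.Colorable (m + n) := by
  classical
  obtain ⟨c⟩ := hm
  obtain ⟨d⟩ := hn
  let f : V → Fin m ⊕ Fin n := fun v =>
    if hv : v ∈ S then Sum.inl (c ⟨v, hv⟩) else Sum.inr (d ⟨v, hv⟩)
  have hf : ∀ {v w}, G.Adj v w → f v ≠ f w := by
    intro v w hvw
    by_cases hv : v ∈ S <;> by_cases hw : w ∈ S <;> simp only [f, hv, hw, dif_pos, dif_neg,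
      not_false_eq_true, ne_eq, Sum.inl.injEq, Sum.inr.injEq, reduceCtorEq]
    · exact c.valid (v := ⟨v, hv⟩) (w := ⟨w, hw⟩) hvw
    · exact d.valid (v := ⟨v, hv⟩) (w := ⟨w, hw⟩) hvw
  simpa using (Coloring.mk f hf).colorable

open Classical in
/-- If the `n`-colorable induced subgraph on `S` contains an `n`-clique `K` inside the union of
two completely joined sets `A` and `B`, then the color classes of `S` split according to whether
they meet `K ∩ A` or `K ∩ B`. -/
theorem exists_split_of_colorable_induce {V : Type*} {G : SimpleGraph V} {A B S : Set V} {n : ℕ}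
    {K : Finset V} (hK : G.IsNClique n K) (hKAB : ↑K ⊆ A ∪ B) (hS : A ∪ B ⊆ S)
    (hAB : ∀ a ∈ A, ∀ b ∈ B, G.Adj a b) (hc : (G.induce S).Colorable n) :
    ∃ X ⊆ S, A ⊆ X ∧ Disjoint X B ∧
      (∀ s : Finset V, G.IsClique s → ↑s ⊆ X → s.card ≤ (K.filter (· ∈ A)).card) ∧
      (∀ s : Finset V, G.IsClique s → ↑s ⊆ S \ X → s.card ≤ (K.filter (· ∈ B)).card) := by
  obtain ⟨c⟩ := hc
  obtain ⟨f, hf⟩ : ∃ f : V → ℕ, ∀ v (hv : v ∈ S), f v = c ⟨v, hv⟩ :=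
    ⟨fun v => if hv : v ∈ S then c ⟨v, hv⟩ else 0, fun v hv => dif_pos hv⟩
  have hlt : ∀ v ∈ S, f v < n := fun v hv => hf v hv ▸ (c ⟨v, hv⟩).2
  have hadj : ∀ v ∈ S, ∀ w ∈ S, G.Adj v w → f v ≠ f w := by
    intro v hv w hw hvw h
    rw [hf v hv, hf w hw] at h
    exact c.valid (v := ⟨v, hv⟩) (w := ⟨w, hw⟩) hvw (Fin.ext h)
  have hinj : ∀ s : Finset V, G.IsClique s → ↑s ⊆ S → Set.InjOn f s := by
    intro s hs hsS v hv w hw h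
    by_contra hvw
    exact hadj v (hsS hv) w (hsS hw) (hs hv hw hvw) h
  have hsurj : ∀ v ∈ S, ∃ k ∈ K, f k = f v := by
    have himage : K.image f = Finset.range n := by
      refine Finset.eq_of_subset_of_card_le (fun i hi => ?_) ?_
      · obtain ⟨k, hk, rfl⟩ := Finset.mem_image.1 hi
        exact Finset.mem_range.2 (hlt k (hS (hKAB hk)))
      · rw [Finset.card_image_of_injOn (hinj K hK.isClique (hKAB.trans hS)), hK.card_eq,
          Finset.card_range]
    intro v hv
    exact Finset.mem_image.1 (himage ▸ Finset.mem_range.2 (hlt v hv))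
  have hcard : ∀ s L : Finset V, G.IsClique s → ↑s ⊆ S → (∀ v ∈ s, ∃ k ∈ L, f k = f v) →
      s.card ≤ L.card := by
    intro s L hs hsS hsL
    rw [← Finset.card_image_of_injOn (hinj s hs hsS)]
    refine (Finset.card_le_card fun i hi => ?_).trans (Finset.card_image_le (s := L) (f := f))
    obtain ⟨v, hv, rfl⟩ := Finset.mem_image.1 hi
    exact Finset.mem_image.2 (hsL v hv)
  refine ⟨{v | v ∈ S ∧ ∃ k ∈ K.filter (· ∈ A), f k = f v}, fun v hv => hv.1, ?_, ?_, ?_, ?_⟩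
  · intro v hv
    have hvS := hS (Or.inl hv)
    obtain ⟨k, hk, hkv⟩ := hsurj v hvS
    refine ⟨hvS, k, Finset.mem_filter.2 ⟨hk, (hKAB hk).resolve_right fun hkB => ?_⟩, hkv⟩
    exact hadj v hvS k (hS (Or.inr hkB)) (hAB v hv k hkB) hkv.symm
  · rw [Set.disjoint_left]
    rintro v ⟨hvS, k, hk, hkv⟩ hvB
    have hkA := (Finset.mem_filter.1 hk).2
    exact hadj k (hS (Or.inl hkA)) v hvS (hAB k hkA v hvB) hkv
  · exact fun s hs hsX => hcard s _ hs (fun v hv => (hsX hv).1) fun v hv => (hsX hv).2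
  · intro s hs hsX
    refine hcard s _ hs (fun v hv => (hsX hv).1) fun v hv => ?_
    obtain ⟨k, hk, hkv⟩ := hsurj v (hsX hv).1
    refine ⟨k, Finset.mem_filter.2 ⟨hk, (hKAB hk).resolve_left fun hkA => ?_⟩, hkv⟩
    exact (hsX hv).2 ⟨(hsX hv).1, k, Finset.mem_filter.2 ⟨hk, hkA⟩, hkv⟩

/-- In a minimally imperfect graph with skew partition `A, B, C, D`, no
`ω(G)`-clique is contained in `A ∪ B`. -/
theorem no_max_clique_in_A_union_B {V : Type*} [Fintype V] (G : SimpleGraph V)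
    (A B C D : Set V) (hmi : MinimallyImperfect G)
    (hsp : IsSkewPartition G A B C D) :
    ∀ s : Finset V, G.IsNClique G.cliqueNum s → ¬ (↑s ⊆ A ∪ B) := by
  classical
  intro K hK hKAB
  obtain ⟨⟨a, ha⟩, ⟨b, hb⟩, ⟨c, hc⟩, ⟨d, hd⟩, hcover, hdAB, hdAC, hdAD, hdBC, hdBD, hdCD,
    hAB, hCD⟩ := hsp
  have hcol : ∀ T : Set V, T.Nonempty → (G.induce Tᶜ).Colorable G.cliqueNum := by
    rintro T ⟨t, ht⟩
    exact hmi.colorable_induce (fun h => (h.ge (Set.mem_univ t) : t ∈ Tᶜ) ht)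
      fun s hs _ => IsClique.card_le_cliqueNum (tc := hs)
  have hABC : A ∪ B ⊆ Cᶜ := (Set.disjoint_union_left.2 ⟨hdAC, hdBC⟩).subset_compl_right
  have hABD : A ∪ B ⊆ Dᶜ := (Set.disjoint_union_left.2 ⟨hdAD, hdBD⟩).subset_compl_right
  obtain ⟨X, hXD, hAX, hXB, hX, hX'⟩ :=
    exists_split_of_colorable_induce hK hKAB hABD hAB (hcol D ⟨d, hd⟩)
  obtain ⟨Y, hYC, hAY, hYB, hY, hY'⟩ :=
    exists_split_of_colorable_induce hK hKAB hABC hAB (hcol C ⟨c, hc⟩)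
  have hmem : ∀ v, v ∉ C → v ∉ D → v ∈ A ∨ v ∈ B := by
    intro v hvC hvD
    have hv : v ∈ A ∪ B ∪ C ∪ D := hcover ▸ Set.mem_univ v
    exact (hv.resolve_right hvD).resolve_right hvC
  have hclique : ∀ s : Finset V, G.IsClique s → ↑s ⊆ Dᶜ ∨ ↑s ⊆ Cᶜ := by
    intro s hs
    by_contra! h
    obtain ⟨x, hx, hxD⟩ := Set.not_subset.1 h.1
    obtain ⟨y, hy, hyC⟩ := Set.not_subset.1 h.2
    rw [Set.notMem_compl_iff] at hxD hyC
    exact hCD y hyC x hxD (hs hy hx (hdCD.ne_of_mem hyC hxD))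
  have hXY : ∀ v ∈ X ∪ Y, (v ∉ D → v ∈ X) ∧ (v ∉ C → v ∈ Y) := by
    rintro v (hv | hv)
    · exact ⟨fun _ => hv, fun hvC =>
        hAY ((hmem v hvC (hXD hv)).resolve_right (Set.disjoint_left.1 hXB hv))⟩
    · exact ⟨fun hvD => hAX ((hmem v (hYC hv) hvD).resolve_right (Set.disjoint_left.1 hYB hv)),
        fun _ => hv⟩
  have hcolA : (G.induce (X ∪ Y)).Colorable (K.filter (· ∈ A)).card := by
    refine hmi.colorable_induce (fun h => ?_) fun s hs hsXY => ?_
    · rcases (h ▸ Set.mem_univ b : b ∈ X ∪ Y) with hbX | hbY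
      exacts [Set.disjoint_left.1 hXB hbX hb, Set.disjoint_left.1 hYB hbY hb]
    · rcases hclique s hs with hsD | hsC
      · exact hX s hs fun v hv => (hXY v (hsXY hv)).1 (hsD hv)
      · exact hY s hs fun v hv => (hXY v (hsXY hv)).2 (hsC hv)
  have hcolB : (G.induce (X ∪ Y)ᶜ).Colorable (K.filter (· ∈ B)).card := by
    refine hmi.colorable_induce (fun h => ?_) fun s hs hsXY => ?_
    · exact (h ▸ Set.mem_univ a : a ∈ (X ∪ Y)ᶜ) (Or.inl (hAX ha))
    · rcases hclique s hs with hsD | hsC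
      · exact hX' s hs fun v hv => ⟨hsD hv, fun hvX => hsXY hv (Or.inl hvX)⟩
      · exact hY' s hs fun v hv => ⟨hsC hv, fun hvY => hsXY hv (Or.inr hvY)⟩
  refine hmi.not_colorable_cliqueNum ((colorable_add_of_induce_compl hcolA hcolB).mono ?_)
  rw [← hK.card_eq, ← Finset.card_union_of_disjoint]
  · exact Finset.card_le_card (Finset.union_subset (Finset.filter_subset _ _)
      (Finset.filter_subset _ _))
  · exact Finset.disjoint_filter.2 fun v _ hvA hvB => Set.disjoint_left.1 hdAB hvA hvB
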